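/- arXiv:1211.3336 — 2 statements merged into one kernel-verified Lean document; each statement's English description precedes it below -/
import Mathlib

section
/- Let λ ∈ ℝ and let φ : (0,∞) → ℝ be twice continuously differentiable with φ'(r) > 0 for all r > 0. Suppose there is R > 0 such that for all r ≥ R both λ² − m² + φ'(r)²/2 > 0 and (1/2)φ'(r)² + 2r φ'(r) φ''(r) ≥ (n−1)φ''(r) + (n−1)² φ'(r)/r + r φ''(r)²/(2φ'(r)) + 3n/(8r) + m/(8 r φ'(r)) + |φ''(r)|/(4φ'(r)). Then for every smooth compactly supported v : ℝⁿ → ℂ^N whose support is contained in {x : |x| > R}, ∫_{ℝⁿ} (λ² − m² + φ'(|x|)²/2) e^{2φ(|x|)} |v(x)|² dx ≤ ∫_{ℝⁿ} (n/4 + 2λ²|x|/φ'(|x|) + 2|x|φ'(|x|)) e^{2φ(|x|)} |(D_m v)(x) − λ v(x)|² dx. -/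
open MeasureTheory

noncomputable section

/-- The free Dirac operator `D_m u = −i ∑ⱼ αʲ ∂ⱼu + m β u` on functions `ℝⁿ → ℂ^N`. -/
def diracOp {n N : ℕ} (m : ℝ) (α : Fin n → Matrix (Fin N) (Fin N) ℂ)
    (β : Matrix (Fin N) (Fin N) ℂ)
    (u : EuclideanSpace ℝ (Fin n) → EuclideanSpace ℂ (Fin N))
    (x : EuclideanSpace ℝ (Fin n)) : EuclideanSpace ℂ (Fin N) :=
  (-Complex.I) • ∑ j, Matrix.toEuclideanLin (α j) (fderiv ℝ u x (EuclideanSpace.single j 1))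
    + (m : ℂ) • Matrix.toEuclideanLin β (u x)

section PointwiseAlgebra

variable {E : Type*} [NormedAddCommGroup E] [InnerProductSpace ℝ E]

/-- The integrand of the virial identity, written as a sum of squares and first order terms. -/
theorem virial_integrand_eq (A b : E →L[ℝ] E) (d h k l m r : ℝ)
    (hA : ∀ x y, inner ℝ (A x) y = -inner ℝ x (A y)) (hb : ∀ x y, inner ℝ (b x) y = inner ℝ x (b y))
    (hAA : ∀ x, A (A x) = -(r ^ 2) • x) (hAb : ∀ x, b (A x) = -A (b x))
    (hbb : ∀ x, b (b x) = x)
    (w M u p f q : E) (hp : p = l • w + h • A w) (hf : f = u + m • b w - p)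
    (hq : q = l • M + (k * r ^ 2 + h) • A w + h • A M) :
    -2 * (d * inner ℝ f p + inner ℝ (-u + m • b M - q) p + inner ℝ f q
        + inner ℝ M (l • u - (k * r ^ 2 + d * h) • w - h • A u - (2 * h) • M))
      = ‖m • b w - p‖ ^ 2 + 4 * h * ‖M‖ ^ 2
        + (l ^ 2 - m ^ 2 + h ^ 2 * r ^ 2 + 2 * (h * r ^ 2) * (k * r ^ 2 + h)) * ‖w‖ ^ 2
        + 2 * (d * h + k * r ^ 2) * inner ℝ w M - 4 * inner ℝ f (h • A M + l • M)
        - 2 * inner ℝ f ((d * h + k * r ^ 2) • A w + ((d - 1) * l) • w) := by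
  subst hf hq hp
  have e1 : inner ℝ w (A w) = 0 := by
    have := hA w w; rw [real_inner_comm] at this; linarith
  have e2 : inner ℝ M (A M) = 0 := by
    have := hA M M; rw [real_inner_comm] at this; linarith
  have e3 : ∀ x y, inner ℝ (A x) (A y) = r ^ 2 * inner ℝ x y := fun x y => by
    rw [hA, hAA, inner_smul_right]; ring
  have e4 : ∀ x y, inner ℝ (b x) (b y) = inner ℝ x y := fun x y => by
    rw [hb, hbb]
  have e5 : inner ℝ (b w) (A M) = inner ℝ (b M) (A w) := by
    rw [hb, hAb, inner_neg_right, ← hA, real_inner_comm]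
  have e6 : inner ℝ M (A w) = - inner ℝ w (A M) := by
    rw [← hA, real_inner_comm]
  have e7 : inner ℝ M (A u) = - inner ℝ u (A M) := by
    rw [← hA, real_inner_comm]
  have e8 : inner ℝ (b M) w = inner ℝ (b w) M := by
    rw [hb, real_inner_comm]
  simp only [← real_inner_self_eq_norm_sq, inner_add_left, inner_add_right, inner_sub_left,
    inner_sub_right, inner_smul_left, inner_smul_right, inner_neg_left,
    conj_trivial, e3, e4]
  have c1 := real_inner_comm (b w) (A w)
  have c2 := real_inner_comm (b w) w
  have c3 := real_inner_comm w M
  have c4 : inner ℝ (A w) w = 0 := by rw [real_inner_comm, e1]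
  have c5 : inner ℝ (A w) M = - inner ℝ w (A M) := hA _ _
  have c7 := real_inner_comm u M
  have c11 := real_inner_comm w (A M)
  simp only [e1, e5, e6, e7, e8, c1, c2, c3, c4, c5, c7, c11]
  ring

/-- Completing squares in the integrand of the virial identity. -/
theorem weighted_square_nonneg (A : E →L[ℝ] E) (d h s l r : ℝ)
    (hA : ∀ x y, inner ℝ (A x) y = -inner ℝ x (A y))
    (hAA : ∀ x, A (A x) = -(r ^ 2) • x) (hd : d = 1 ∨ 2 ≤ d) (hh : 0 < h) (hr : 0 < r)
    (hs : h * ((d - 1) * s + (d - 1) ^ 2 + s ^ 2 / 2) ≤ (h * r) ^ 2 * (1 / 2 + 2 * s))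
    (w M f : E) :
    0 ≤ 2 * (l ^ 2 / h + h * r ^ 2) * ‖f‖ ^ 2 + 4 * h * ‖M‖ ^ 2
        + (h * r) ^ 2 * (1 / 2 + 2 * s) * ‖w‖ ^ 2
        + 2 * (h * (s + (d - 1))) * inner ℝ w M - 4 * inner ℝ f (h • A M + l • M)
        - 2 * inner ℝ f ((h * (s + (d - 1))) • A w + ((d - 1) * l) • w) := by
  have e1 : inner ℝ w (A w) = 0 := by
    have := hA w w; rw [real_inner_comm] at this; linarith
  have e1' : inner ℝ f (A f) = 0 := by
    have := hA f f; rw [real_inner_comm] at this; linarith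
  have e3 : ∀ x y, inner ℝ (A x) (A y) = r ^ 2 * inner ℝ x y := fun x y => by
    rw [hA, hAA, inner_smul_right]; ring
  set ν := d - 1 with hν
  set κ := l ^ 2 / h + h * r ^ 2 with hκ
  have hκ0 : 0 < κ := by positivity
  have sq1 : 0 ≤ ‖(4 * h) • M + (h * (s + ν)) • w - (2 : ℝ) • (l • f - h • A f)‖ ^ 2 := by
    positivity
  have sq2 : 0 ≤ ‖(2 * κ) • f + ((s - ν) * l) • w - ((s + ν) * h) • A w‖ ^ 2 := by positivity
  rw [← real_inner_self_eq_norm_sq] at sq1 sq2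
  simp only [inner_add_left, inner_add_right, inner_sub_left,
    inner_sub_right, inner_smul_left, inner_smul_right, conj_trivial, e3] at sq1 sq2 ⊢
  have c1 := real_inner_comm f (A f)
  have c2 := real_inner_comm w (A w)
  have c3 : inner ℝ f (A M) = - inner ℝ M (A f) := by rw [real_inner_comm, hA]
  have c4 : inner ℝ (A f) M = inner ℝ M (A f) := real_inner_comm _ _
  have c5 : inner ℝ (A f) w = - inner ℝ f (A w) := hA _ _
  have c6 : inner ℝ w (A f) = - inner ℝ f (A w) := by rw [real_inner_comm, hA]
  have c7 : inner ℝ (A w) f = inner ℝ f (A w) := real_inner_comm _ _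
  have c8 := real_inner_comm f w
  have c9 := real_inner_comm f M
  have c10 := real_inner_comm w M
  simp only [c1, c2, e1, e1', c3, c4, c5, c6, c7, c8, c9, c10,
    real_inner_self_eq_norm_sq] at sq1 sq2 ⊢
  have hsν : (s - ν) ^ 2 ≤ (s + ν) ^ 2 + 2 * ν ^ 2 := by
    have hs4 : 0 ≤ 1 / 2 + 2 * s := by
      have h0 : 0 ≤ h * (ν * s + ν ^ 2 + s ^ 2 / 2) :=
        mul_nonneg hh.le (by nlinarith [sq_nonneg (ν + s), sq_nonneg ν])
      exact nonneg_of_mul_nonneg_right (h0.trans hs) (by positivity)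
    rcases hd with hd | hd
    · have : ν = 0 := by rw [hν, hd]; ring
      simp [this]
    · have : 1 ≤ ν := by linarith
      have : 0 ≤ ν * (ν + 2 * s) := mul_nonneg (by linarith) (by linarith)
      linarith
  have hκh : κ * h = l ^ 2 + h ^ 2 * r ^ 2 := by
    rw [hκ]; field_simp
  have key : ((s - ν) * l) ^ 2 + ((s + ν) * h) ^ 2 * r ^ 2
      ≤ ((s + ν) ^ 2 + 2 * ν ^ 2) * (κ * h) := by
    rw [hκh]
    have := mul_le_mul_of_nonneg_right hsν (sq_nonneg l)
    have := sq_nonneg (ν * h * r)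
    linarith
  have key2 := mul_le_mul_of_nonneg_right key (sq_nonneg ‖w‖)
  have hs2 := mul_le_mul_of_nonneg_right hs (sq_nonneg ‖w‖)
  have hκh0 : 0 < 4 * (κ * h) := by positivity
  clear_value κ
  refine nonneg_of_mul_nonneg_right ?_ hκh0
  have t1 := mul_nonneg hκ0.le sq1
  have t2 := mul_nonneg hh.le sq2
  have t3 := mul_nonneg hh.le (sub_nonneg.2 key2)
  have t4 := mul_nonneg hκh0.le (sub_nonneg.2 hs2)
  refine (add_nonneg (add_nonneg t1 t2) (add_nonneg t3 t4)).trans_eq ?_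
  linear_combination (-4 * κ * ‖f‖ ^ 2) * hκh

end PointwiseAlgebra

section Virial

theorem integral_fderiv_apply_eq_zero {X : Type*} [NormedAddCommGroup X] [NormedSpace ℝ X]
    [FiniteDimensional ℝ X] [MeasurableSpace X] [BorelSpace X] (μ : Measure X)
    [μ.IsAddHaarMeasure] {g : X → ℝ} (hg : ContDiff ℝ 1 g) (hc : HasCompactSupport g) (v : X) :
    Integrable (fun x => fderiv ℝ g x v) μ ∧ ∫ x, fderiv ℝ g x v ∂μ = 0 := by
  have hi : Integrable (fun x => fderiv ℝ g x v) μ :=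
    ((hg.continuous_fderiv one_ne_zero).clm_apply continuous_const).integrable_of_hasCompactSupport
      (hc.fderiv_apply ℝ v)
  refine ⟨hi, ?_⟩
  have := integral_mul_fderiv_eq_neg_fderiv_mul_of_integrable (μ := μ) (f := fun _ : X => (1 : ℝ))
    (g := g) (v := v) (by simp) (by simpa using hi)
    (by simpa using hg.continuous.integrable_of_hasCompactSupport hc)
    (fun x _ => differentiableAt_const _) (fun x _ => hg.differentiable one_ne_zero x)
  simpa using this

theorem contDiff_of_eventuallyEq_zero {X F G : Type*} [NormedAddCommGroup X] [NormedSpace ℝ X]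
    [NormedAddCommGroup F] [NormedSpace ℝ F] [Zero G] {k : WithTop ℕ∞} {w : X → G} {f : X → F}
    (hf : ∀ x ∈ tsupport w, ContDiffAt ℝ k f x) (h0 : ∀ x, w x = 0 → f x = 0) :
    ContDiff ℝ k f := by
  refine contDiff_iff_contDiffAt.2 fun x => ?_
  by_cases hx : x ∈ tsupport w
  · exact hf x hx
  · refine (contDiffAt_const (c := (0 : F))).congr_of_eventuallyEq ?_
    filter_upwards [notMem_tsupport_iff_eventuallyEq.1 hx] with y hy using h0 y hy

variable {n : ℕ} {E : Type*} [NormedAddCommGroup E] [InnerProductSpace ℝ E]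

/-- The massless Dirac operator `∑ⱼ A(eⱼ) ∂ⱼ` of a Clifford multiplication `A`. -/
def cliffordDirac (A : EuclideanSpace ℝ (Fin n) →L[ℝ] E →L[ℝ] E)
    (w : EuclideanSpace ℝ (Fin n) → E) (x : EuclideanSpace ℝ (Fin n)) : E :=
  ∑ j, A (EuclideanSpace.single j 1) (fderiv ℝ w x (EuclideanSpace.single j 1))

theorem sum_inner_single_smul {F : Type*} [NormedAddCommGroup F] [NormedSpace ℝ F]
    (L : EuclideanSpace ℝ (Fin n) →L[ℝ] F)
    (x : EuclideanSpace ℝ (Fin n)) :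
    ∑ j, (x j) • L (EuclideanSpace.single j 1) = L x := by
  have := (EuclideanSpace.basisFun (Fin n) ℝ).sum_repr x
  conv_rhs => rw [← this]
  simp [map_sum]

theorem clifford_polarization {A : EuclideanSpace ℝ (Fin n) →L[ℝ] E →L[ℝ] E}
    (hAA : ∀ x e, A x (A x e) = -(‖x‖ ^ 2) • e) (x y : EuclideanSpace ℝ (Fin n)) (e : E) :
    A x (A y e) = -A y (A x e) - (2 * inner ℝ x y) • e := by
  have h := hAA (x + y) e
  have h2 : ‖x + y‖ ^ 2 = ‖x‖ ^ 2 + 2 * inner ℝ x y + ‖y‖ ^ 2 := norm_add_sq_real x y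
  simp only [map_add, add_apply, hAA, h2] at h
  rw [eq_sub_iff_add_eq, eq_neg_iff_add_eq_zero]
  have : A x (A y e) + A y (A x e) + (2 * inner ℝ x y) • e =
    (-‖x‖ ^ 2 • e + A y (A x e) + (A x (A y e) + -‖y‖ ^ 2 • e)) -
     (-(‖x‖ ^ 2 + 2 * inner ℝ x y + ‖y‖ ^ 2) • e) := by module
  rw [h, sub_self] at this
  rw [← this]; abel

theorem sum_clifford_clifford {A : EuclideanSpace ℝ (Fin n) →L[ℝ] E →L[ℝ] E}
    (hAA : ∀ x e, A x (A x e) = -(‖x‖ ^ 2) • e) (x : EuclideanSpace ℝ (Fin n))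
    (L : EuclideanSpace ℝ (Fin n) →L[ℝ] E) :
    ∑ j, A (EuclideanSpace.single j 1) (A x (L (EuclideanSpace.single j 1)))
      = -A x (∑ j, A (EuclideanSpace.single j 1) (L (EuclideanSpace.single j 1)))
        - (2 : ℝ) • L x := by
  simp only [fun j e => clifford_polarization hAA (EuclideanSpace.single j 1) x e]
  rw [Finset.sum_sub_distrib, map_sum, Finset.sum_neg_distrib, ← sum_inner_single_smul L x,
    Finset.smul_sum]
  simp [EuclideanSpace.inner_single_left, mul_smul]

theorem virial_pointwise {A : EuclideanSpace ℝ (Fin n) →L[ℝ] E →L[ℝ] E} {b : E →L[ℝ] E}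
    (hAs : ∀ x e e', inner ℝ (A x e) e' = -inner ℝ e (A x e'))
    (hAA : ∀ x e, A x (A x e) = -(‖x‖ ^ 2) • e)
    {w : EuclideanSpace ℝ (Fin n) → E} (hw : ContDiff ℝ 2 w)
    {h : EuclideanSpace ℝ (Fin n) → ℝ} {x : EuclideanSpace ℝ (Fin n)} {k : ℝ}
    (hh : HasFDerivAt h (k • innerSL ℝ x) x) (l m : ℝ) {p f : EuclideanSpace ℝ (Fin n) → E}
    (hp : p = fun x => l • w x + h x • A x (w x))
    (hf : f = fun x => cliffordDirac A w x + m • b (w x) - p x) :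
    ∑ j, fderiv ℝ (fun y => y j * inner ℝ (f y) (p y)
        - inner ℝ (A (EuclideanSpace.single j 1) (fderiv ℝ w y y)) (p y)) x
        (EuclideanSpace.single j 1)
      = n * inner ℝ (f x) (p x)
        + inner ℝ (-cliffordDirac A w x + m • b (fderiv ℝ w x x)
          - (l • fderiv ℝ w x x + (k * ‖x‖ ^ 2 + h x) • A x (w x)
            + h x • A x (fderiv ℝ w x x))) (p x)
        + inner ℝ (f x) (l • fderiv ℝ w x x + (k * ‖x‖ ^ 2 + h x) • A x (w x)
            + h x • A x (fderiv ℝ w x x))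
        + inner ℝ (fderiv ℝ w x x) (l • cliffordDirac A w x
            - (k * ‖x‖ ^ 2 + n * h x) • w x - h x • A x (cliffordDirac A w x)
            - (2 * h x) • fderiv ℝ w x x) := by
  have hwd : ∀ y, HasFDerivAt w (fderiv ℝ w y) y := fun y =>
    (hw.differentiable two_ne_zero y).hasFDerivAt
  have hw'd : HasFDerivAt (fderiv ℝ w) (fderiv ℝ (fderiv ℝ w) x) x :=
    ((hw.fderiv_right (m := 1) (by norm_num)).differentiable one_ne_zero x).hasFDerivAt
  set W := fderiv ℝ (fderiv ℝ w) x with hW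
  have hsymm : ∀ y z, W y z = W z y := by
    intro y z
    exact (hw.contDiffAt.isSymmSndFDerivAt (by simp)) y z
  have hAx : HasFDerivAt (fun y => A y (w y)) (A x ∘L fderiv ℝ w x + A.flip (w x)) x :=
    A.hasFDerivAt.clm_apply (hwd x)
  obtain ⟨P, hP, hpd⟩ : ∃ P : EuclideanSpace ℝ (Fin n) →L[ℝ] E,
      (∀ y, P y = l • fderiv ℝ w x y + (k * inner ℝ x y) • A x (w x)
        + h x • (A y (w x) + A x (fderiv ℝ w x y))) ∧ HasFDerivAt p P x := by
    refine ⟨_, fun y => ?_,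
      (((hwd x).const_smul l).add (hh.smul hAx)).congr_of_eventuallyEq (.of_eq hp)⟩
    simp only [add_apply, smul_apply, ContinuousLinearMap.smulRight_apply,
      ContinuousLinearMap.comp_apply, ContinuousLinearMap.flip_apply, innerSL_apply_apply,
      smul_eq_mul]
    module
  obtain ⟨D, hD, hMd⟩ : ∃ D : EuclideanSpace ℝ (Fin n) →L[ℝ] E,
      (∀ y, D y = W y x + fderiv ℝ w x y) ∧ HasFDerivAt (fun y => fderiv ℝ w y y) D x := by
    refine ⟨_, fun y => ?_, hw'd.clm_apply (hasFDerivAt_id x)⟩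
    simp [add_comm]
  have hud : HasFDerivAt (cliffordDirac A w)
      (∑ j, A (EuclideanSpace.single j 1) ∘L W.flip (EuclideanSpace.single j 1)) x := by
    refine HasFDerivAt.fun_sum fun j _ => ?_
    refine (A (EuclideanSpace.single j 1)).hasFDerivAt.comp x ?_
    have := hw'd.clm_apply (hasFDerivAt_const (EuclideanSpace.single j (1:ℝ)) x)
    convert this using 1
    ext y; simp
  have hbd : HasFDerivAt (fun y => b (w y)) (b ∘L fderiv ℝ w x) x :=
    b.hasFDerivAt.comp x (hwd x)
  obtain ⟨F, hF, hfd⟩ : ∃ F : EuclideanSpace ℝ (Fin n) →L[ℝ] E,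
      (F x = ∑ j, A (EuclideanSpace.single j 1) (W (EuclideanSpace.single j 1) x)
        + m • b (fderiv ℝ w x x) - P x) ∧ HasFDerivAt f F x := by
    refine ⟨_, ?_, ((hud.add (hbd.const_smul m)).sub hpd).congr_of_eventuallyEq (.of_eq hf)⟩
    simp [sum_apply, hsymm x]
  have hterm (j : Fin n) : fderiv ℝ (fun y => y j * inner ℝ (f y) (p y)
        - inner ℝ (A (EuclideanSpace.single j 1) (fderiv ℝ w y y)) (p y)) x
          (EuclideanSpace.single j 1)
      = x j * (inner ℝ (f x) (P (EuclideanSpace.single j 1))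
          + inner ℝ (F (EuclideanSpace.single j 1)) (p x))
        + inner ℝ (f x) (p x)
        - inner ℝ (A (EuclideanSpace.single j 1) (D (EuclideanSpace.single j 1))) (p x)
        + inner ℝ (fderiv ℝ w x x)
          (A (EuclideanSpace.single j 1) (P (EuclideanSpace.single j 1))) := by
    have h1 := (((EuclideanSpace.proj (𝕜 := ℝ) j).hasFDerivAt (x := x)).mul (hfd.inner ℝ hpd)).sub
      (((A (EuclideanSpace.single j 1)).hasFDerivAt.comp x hMd).inner ℝ hpd)
    have h2 := DFunLike.congr_fun h1.fderiv (EuclideanSpace.single j (1 : ℝ))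
    refine h2.trans ?_
    simp [hAs]
    ring
  have hsF : ∑ j, x j * (inner ℝ (f x) (P (EuclideanSpace.single j 1))
          + inner ℝ (F (EuclideanSpace.single j 1)) (p x))
      = inner ℝ (f x) (P x) + inner ℝ (F x) (p x) := by
    rw [← sum_inner_single_smul P x, ← sum_inner_single_smul F x, inner_sum, sum_inner,
      ← Finset.sum_add_distrib]
    simp [inner_smul_left, inner_smul_right, mul_add]
  have hsD : ∑ j, A (EuclideanSpace.single j 1) (D (EuclideanSpace.single j 1))
      = ∑ j, A (EuclideanSpace.single j 1) (W (EuclideanSpace.single j 1) x)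
        + cliffordDirac A w x := by
    simp [hD, Finset.sum_add_distrib, cliffordDirac]
  have hsP : ∑ j, A (EuclideanSpace.single j 1) (P (EuclideanSpace.single j 1))
      = l • cliffordDirac A w x
            - (k * ‖x‖ ^ 2 + n * h x) • w x - h x • A x (cliffordDirac A w x)
            - (2 * h x) • fderiv ℝ w x x := by
    have h1 : ∑ j, A (EuclideanSpace.single j 1)
          ((inner ℝ x (EuclideanSpace.single j 1)) • A x (w x))
        = -(‖x‖ ^ 2) • w x := by
      have := DFunLike.congr_fun (sum_inner_single_smul A x) (A x (w x))
      rw [← hAA, ← this]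
      simp [EuclideanSpace.inner_single_right]
    have h2 := sum_clifford_clifford hAA x (fderiv ℝ w x)
    simp only [hP, map_add, map_smul, Finset.sum_add_distrib, ← Finset.smul_sum, hAA, mul_smul,
      h2] at h1 ⊢
    rw [h1]
    simp [cliffordDirac]
    module
  rw [Finset.sum_congr rfl fun j _ => hterm j]
  simp only [Finset.sum_add_distrib, Finset.sum_sub_distrib, hsF, ← sum_inner, ← inner_sum, hsD, hsP,
    hF]
  simp [hP, ← Nat.cast_smul_eq_nsmul ℝ, inner_add_left, inner_sub_left, inner_add_right,
    inner_smul_right, inner_smul_left]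
  ring

/-- The virial integrand is a divergence, so its integral vanishes. -/
theorem integral_virial_eq_zero {A : EuclideanSpace ℝ (Fin n) →L[ℝ] E →L[ℝ] E} {b : E →L[ℝ] E}
    (hAs : ∀ x e e', inner ℝ (A x e) e' = -inner ℝ e (A x e'))
    (hAA : ∀ x e, A x (A x e) = -(‖x‖ ^ 2) • e)
    {w : EuclideanSpace ℝ (Fin n) → E} (hw : ContDiff ℝ 2 w) (hwc : HasCompactSupport w)
    {h k : EuclideanSpace ℝ (Fin n) → ℝ} (hh1 : ∀ x ∈ tsupport w, ContDiffAt ℝ 1 h x)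
    (hh : ∀ x ∈ tsupport w, HasFDerivAt h (k x • innerSL ℝ x) x) (l m : ℝ)
    {p f q : EuclideanSpace ℝ (Fin n) → E}
    (hp : p = fun x => l • w x + h x • A x (w x))
    (hf : f = fun x => cliffordDirac A w x + m • b (w x) - p x)
    (hq : q = fun x => l • fderiv ℝ w x x + (k x * ‖x‖ ^ 2 + h x) • A x (w x)
      + h x • A x (fderiv ℝ w x x)) (I : EuclideanSpace ℝ (Fin n) → ℝ)
    (hI : I = fun x => n * inner ℝ (f x) (p x)
        + inner ℝ (-cliffordDirac A w x + m • b (fderiv ℝ w x x) - q x) (p x)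
        + inner ℝ (f x) (q x)
        + inner ℝ (fderiv ℝ w x x) (l • cliffordDirac A w x
            - (k x * ‖x‖ ^ 2 + n * h x) • w x - h x • A x (cliffordDirac A w x)
            - (2 * h x) • fderiv ℝ w x x)) :
    Integrable I ∧ ∫ x, I x = 0 := by
  set Φ : Fin n → EuclideanSpace ℝ (Fin n) → ℝ := fun j y => y j * inner ℝ (f y) (p y)
        - inner ℝ (A (EuclideanSpace.single j 1) (fderiv ℝ w y y)) (p y) with hΦ
  have hw1 : ContDiff ℝ 1 w := hw.of_le (by norm_num)
  have hw' : ContDiff ℝ 1 (fderiv ℝ w) := hw.fderiv_right (by norm_num)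
  have hp0 : ∀ x, w x = 0 → p x = 0 := fun x hx => by simp [hp, hx]
  have hpC : ContDiff ℝ 1 p := by
    refine contDiff_of_eventuallyEq_zero (w := w) (fun x hx => ?_) hp0
    have := hh1 x hx
    rw [hp]
    fun_prop
  have hpc : HasCompactSupport p := hwc.mono (Function.support_subset_iff'.2
    fun x hx => hp0 x (Function.notMem_support.1 hx))
  have huC : ContDiff ℝ 1 (cliffordDirac A w) := by
    unfold cliffordDirac
    fun_prop
  have hfC : ContDiff ℝ 1 f := by
    rw [hf]
    fun_prop
  have hΦC (j : Fin n) : ContDiff ℝ 1 (Φ j) := by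
    have h1 : ContDiff ℝ 1 fun y : EuclideanSpace ℝ (Fin n) => y j := by fun_prop
    have h2 : ContDiff ℝ 1 fun y => fderiv ℝ w y y := hw'.clm_apply contDiff_id
    have h3 : ContDiff ℝ 1 fun y => A (EuclideanSpace.single j 1) (fderiv ℝ w y y) := by fun_prop
    exact (h1.mul (hfC.inner ℝ hpC)).sub (h3.inner ℝ hpC)
  have hΦc (j : Fin n) : HasCompactSupport (Φ j) := hpc.mono (Function.support_subset_iff'.2
    fun x hx => by simp [hΦ, Function.notMem_support.1 hx])
  have hIΦ : I = fun x => ∑ j, fderiv ℝ (Φ j) x (EuclideanSpace.single j 1) := by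
    ext x
    by_cases hx : x ∈ tsupport w
    · rw [hI, hq]
      exact (virial_pointwise hAs hAA hw (hh x hx) l m hp hf).symm
    · have h0 := notMem_tsupport_iff_eventuallyEq.1 hx
      have h1 : w x = 0 := h0.self_of_nhds
      have h2 : fderiv ℝ w x = 0 := by rw [h0.fderiv_eq]; simp
      have h3 (j : Fin n) : fderiv ℝ (Φ j) x = 0 := by
        have : Φ j =ᶠ[nhds x] 0 := by
          filter_upwards [h0] with y hy
          simp [hΦ, hp0 y hy]
        rw [this.fderiv_eq]; simp
      simp [hI, h1, h2, h3, hp0 x h1, hq]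
  have hi (j : Fin n) := integral_fderiv_apply_eq_zero volume (hΦC j) (hΦc j)
    (EuclideanSpace.single j 1)
  rw [hIΦ]
  refine ⟨integrable_finsetSum _ fun j _ => (hi j).1, ?_⟩
  rw [integral_finsetSum _ fun j _ => (hi j).1]
  exact Finset.sum_eq_zero fun j _ => (hi j).2

/-- The derivative of the Euclidean norm away from the origin. -/
theorem hasFDerivAt_norm_inv_smul {X : Type*} [NormedAddCommGroup X] [InnerProductSpace ℝ X]
    {x : X} (hx : x ≠ 0) : HasFDerivAt (fun y : X => ‖y‖) (‖x‖⁻¹ • innerSL ℝ x) x := by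
  have h := (hasStrictFDerivAt_norm_sq x).hasFDerivAt.sqrt (by simpa using hx)
  simp only [Real.sqrt_sq (norm_nonneg _)] at h
  convert h using 1
  ext y
  simp
  ring

theorem contDiffOn_succ_of_hasDerivAt {s : Set ℝ} (hs : IsOpen s) {g g' : ℝ → ℝ} {k : ℕ}
    (h : ∀ r ∈ s, HasDerivAt g (g' r) r) (hg' : ContDiffOn ℝ k g' s) :
    ContDiffOn ℝ (k + 1) g s :=
  (contDiffOn_succ_iff_deriv_of_isOpen hs).2
    ⟨fun r hr => (h r hr).differentiableAt.differentiableWithinAt, by simp,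
      hg'.congr fun r hr => (h r hr).deriv⟩

theorem integrable_mul_norm_sq {X F : Type*} [TopologicalSpace X] [MeasurableSpace X]
    [OpensMeasurableSpace X] {μ : Measure X} [IsFiniteMeasureOnCompacts μ]
    [NormedAddCommGroup F] {f : X → F} (hf : Continuous f) (hc : HasCompactSupport f) {c : X → ℝ}
    (hcont : ∀ x ∈ tsupport f, ContinuousAt c x) : Integrable (fun x => c x * ‖f x‖ ^ 2) μ := by
  have h0 : Function.support (fun x => c x * ‖f x‖ ^ 2) ⊆ Function.support f :=
    Function.support_subset_iff'.2 fun x hx => by simp [Function.notMem_support.1 hx]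
  refine (continuous_of_tsupport fun x hx => ?_).integrable_of_hasCompactSupport (hc.mono h0)
  exact (hcont x (closure_mono h0 hx)).mul (hf.norm.pow 2).continuousAt

/-- The Carleman–Berthier–Georgescu inequality for the conjugated function `w = e^φ v`. -/
theorem integral_conjugated_carleman_le (hn : 1 ≤ n)
    {A : EuclideanSpace ℝ (Fin n) →L[ℝ] E →L[ℝ] E} {b : E →L[ℝ] E}
    (hAs : ∀ x e e', inner ℝ (A x e) e' = -inner ℝ e (A x e'))
    (hAA : ∀ x e, A x (A x e) = -(‖x‖ ^ 2) • e)
    (hbs : ∀ e e', inner ℝ (b e) e' = inner ℝ e (b e')) (hAb : ∀ x e, b (A x e) = -A x (b e))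
    (hbb : ∀ e, b (b e) = e)
    {w : EuclideanSpace ℝ (Fin n) → E} (hw : ContDiff ℝ 2 w) (hwc : HasCompactSupport w)
    {g g' : ℝ → ℝ} (hg : ∀ r ∈ Set.Ioi (0 : ℝ), HasDerivAt g (g' r) r)
    (hg'c : ContinuousOn g' (Set.Ioi 0)) (hg0 : ∀ r ∈ Set.Ioi (0 : ℝ), 0 < g r)
    {R : ℝ} (hR : 0 < R) (hwR : tsupport w ⊆ {x | R < ‖x‖}) (l m c : ℝ) (hc : 0 ≤ c)
    (hstruct : ∀ r : ℝ, R ≤ r →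
      (n - 1 : ℝ) * g' r + (n - 1 : ℝ) ^ 2 * g r / r + r * g' r ^ 2 / (2 * g r)
        ≤ (1 / 2) * g r ^ 2 + 2 * r * g r * g' r) :
    ∫ x, (l ^ 2 - m ^ 2 + g ‖x‖ ^ 2 / 2) * ‖w x‖ ^ 2
      ≤ ∫ x, (c + 2 * l ^ 2 * ‖x‖ / g ‖x‖ + 2 * ‖x‖ * g ‖x‖)
        * ‖cliffordDirac A w x + m • b (w x) - (l • w x + (g ‖x‖ / ‖x‖) • A x (w x))‖ ^ 2 := by
  have hpos : ∀ x ∈ tsupport w, 0 < ‖x‖ := fun x hx => hR.trans (hwR hx)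
  have hgC : ContDiffOn ℝ 1 g (Set.Ioi 0) := by
    have := contDiffOn_succ_of_hasDerivAt (k := 0) isOpen_Ioi hg (by simpa using hg'c)
    simpa using this
  have hgx : ∀ x ∈ tsupport w, ContDiffAt ℝ 1 (fun y => g ‖y‖) x := fun x hx =>
    (hgC.contDiffAt (Ioi_mem_nhds (hpos x hx))).comp x
      (contDiffAt_norm ℝ (norm_pos_iff.1 (hpos x hx)))
  set h : EuclideanSpace ℝ (Fin n) → ℝ := fun x => g ‖x‖ / ‖x‖ with hh
  set k : EuclideanSpace ℝ (Fin n) → ℝ := fun x => (g' ‖x‖ * ‖x‖ - g ‖x‖) / ‖x‖ ^ 3 with hk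
  have hh1 : ∀ x ∈ tsupport w, ContDiffAt ℝ 1 h x := fun x hx =>
    (hgx x hx).div (contDiffAt_norm ℝ (norm_pos_iff.1 (hpos x hx))) (hpos x hx).ne'
  have hhd : ∀ x ∈ tsupport w, HasFDerivAt h (k x • innerSL ℝ x) x := fun x hx => by
    have h0 := hpos x hx
    have h1 := ((hg _ h0).div (hasDerivAt_id _) h0.ne').comp_hasFDerivAt x
      (hasFDerivAt_norm_inv_smul (norm_pos_iff.1 h0))
    refine h1.congr_fderiv ?_
    rw [smul_smul]
    congr 1
    simp only [hk, id]
    field_simp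
  set p : EuclideanSpace ℝ (Fin n) → E := fun x => l • w x + h x • A x (w x) with hp
  set f : EuclideanSpace ℝ (Fin n) → E := fun x => cliffordDirac A w x + m • b (w x) - p x with hf
  set q : EuclideanSpace ℝ (Fin n) → E := fun x => l • fderiv ℝ w x x
    + (k x * ‖x‖ ^ 2 + h x) • A x (w x) + h x • A x (fderiv ℝ w x x) with hq
  obtain ⟨hIi, hI0⟩ := integral_virial_eq_zero (b := b) hAs hAA hw hwc hh1 hhd l m hp hf hq _ rfl
  have hw0 : ∀ x, x ∉ tsupport w → w x = 0 ∧ fderiv ℝ w x = 0 := fun x hx => by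
    have h0 := notMem_tsupport_iff_eventuallyEq.1 hx
    exact ⟨h0.self_of_nhds, by rw [h0.fderiv_eq]; simp⟩
  have hf0 : ∀ x, x ∉ tsupport w → f x = 0 := fun x hx => by
    simp [hf, hp, cliffordDirac, hw0 x hx]
  have hfts : tsupport f ⊆ tsupport w :=
    closure_minimal (Function.support_subset_iff'.2 hf0) (isClosed_tsupport w)
  have hfc : HasCompactSupport f := hwc.mono' (subset_closure.trans hfts)
  have hw' : ContDiff ℝ 1 (fderiv ℝ w) := hw.fderiv_right (by norm_num)
  have hfC : Continuous f := by
    have hp1 : ContDiff ℝ 1 p := by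
      refine contDiff_of_eventuallyEq_zero (w := w) (fun x hx => ?_) (fun x hx => by simp [hp, hx])
      have := hh1 x hx
      have := hw.of_le (show (1 : WithTop ℕ∞) ≤ 2 by norm_num)
      fun_prop
    have := hp1.continuous
    have := hw.continuous
    have := hw'.continuous
    simp only [hf, cliffordDirac]
    fun_prop
  have hLi : Integrable fun x => (l ^ 2 - m ^ 2 + g ‖x‖ ^ 2 / 2) * ‖w x‖ ^ 2 := by
    refine integrable_mul_norm_sq hw.continuous hwc fun x hx => ?_
    have := (hgx x hx).continuousAt
    exact continuousAt_const.add ((this.pow 2).div_const 2)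
  have hRi : Integrable fun x => (c + 2 * l ^ 2 * ‖x‖ / g ‖x‖ + 2 * ‖x‖ * g ‖x‖) * ‖f x‖ ^ 2 := by
    refine integrable_mul_norm_sq hfC hfc fun x hx => ?_
    have := (hgx x (hfts hx)).continuousAt
    have h0 := (hg0 _ (hpos x (hfts hx))).ne'
    have hnorm : ContinuousAt (fun y : EuclideanSpace ℝ (Fin n) => ‖y‖) x :=
      continuous_norm.continuousAt
    exact (continuousAt_const.add ((continuousAt_const.mul hnorm).div this h0)).add
      ((continuousAt_const.mul hnorm).mul this)
  rw [← add_zero (∫ x, _ * ‖w x‖ ^ 2), ← mul_zero (2 : ℝ), ← hI0, ← integral_const_mul,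
    ← integral_add hLi (hIi.const_mul 2)]
  refine integral_mono (hLi.add (hIi.const_mul 2)) hRi fun x => ?_
  by_cases hx : x ∈ tsupport w
  swap
  · simp [hw0 x hx, hf0 x hx, cliffordDirac, hq, hp]
  have h0 := hpos x hx
  have hgp := hg0 _ h0
  have hr := hwR hx
  have hv := virial_integrand_eq (A x) b n (h x) (k x) l m ‖x‖ (hAs x) hbs (hAA x) (hAb x) hbb
    (w x) (fderiv ℝ w x x) (cliffordDirac A w x) (p x) (f x) (q x) rfl rfl rfl
  have hs := hstruct _ (le_of_lt hr)
  have hsq := weighted_square_nonneg (A x) n (h x) (g' ‖x‖ * ‖x‖ / g ‖x‖) l ‖x‖ (hAs x) (hAA x)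
    (by
      rcases hn.eq_or_lt with h1 | h1
      · left; simp [← h1]
      · right; exact_mod_cast h1) (by positivity) h0 (by
      convert hs using 1 <;> simp only [hh] <;> field_simp) (w x) (fderiv ℝ w x x) (f x)
  have hhr : h x * ‖x‖ = g ‖x‖ := by simp only [hh]; field_simp
  have hkr : k x * ‖x‖ ^ 2 + h x = g' ‖x‖ := by simp only [hh, hk]; field_simp; ring
  have hhs : h x * (g' ‖x‖ * ‖x‖ / g ‖x‖) = g' ‖x‖ := by simp only [hh]; field_simp
  have e1 : 2 * l ^ 2 * ‖x‖ / g ‖x‖ + 2 * ‖x‖ * g ‖x‖ = 2 * (l ^ 2 / h x + h x * ‖x‖ ^ 2) := by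
    rw [← hhr]; have : h x ≠ 0 := by positivity
    field_simp
  have e2 : (n : ℝ) * h x + k x * ‖x‖ ^ 2 = h x * (g' ‖x‖ * ‖x‖ / g ‖x‖ + (n - 1)) := by
    rw [mul_add, hhs, ← hkr]; ring
  have e3 : l ^ 2 - m ^ 2 + h x ^ 2 * ‖x‖ ^ 2 + 2 * (h x * ‖x‖ ^ 2) * (k x * ‖x‖ ^ 2 + h x)
      = (l ^ 2 - m ^ 2 + g ‖x‖ ^ 2 / 2)
        + (h x * ‖x‖) ^ 2 * (1 / 2 + 2 * (g' ‖x‖ * ‖x‖ / g ‖x‖)) := by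
    rw [hkr, hhr, ← mul_pow, hhr, show h x * ‖x‖ ^ 2 = g ‖x‖ * ‖x‖ by rw [← hhr]; ring]
    field_simp
    ring
  rw [e2, e3] at hv
  have hcf : 0 ≤ c * ‖f x‖ ^ 2 := by positivity
  have hZ : 0 ≤ ‖m • b (w x) - p x‖ ^ 2 := by positivity
  rw [add_assoc c, e1]
  beta_reduce
  linarith

end Virial

section Clifford

variable {n N : ℕ}

/-- A complex matrix as a real-linear continuous map of `ℂ^N`. -/
def matrixRealCLM (M : Matrix (Fin N) (Fin N) ℂ) :
    EuclideanSpace ℂ (Fin N) →L[ℝ] EuclideanSpace ℂ (Fin N) :=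
  (Matrix.toEuclideanLin M).toContinuousLinearMap.restrictScalars ℝ

theorem matrixRealCLM_apply (M : Matrix (Fin N) (Fin N) ℂ) (e : EuclideanSpace ℂ (Fin N)) :
    matrixRealCLM M e = Matrix.toEuclideanLin M e := rfl

theorem matrixRealCLM_matrixRealCLM (M M' : Matrix (Fin N) (Fin N) ℂ)
    (e : EuclideanSpace ℂ (Fin N)) :
    matrixRealCLM M (matrixRealCLM M' e) = matrixRealCLM (M * M') e := by
  simp [matrixRealCLM_apply, Matrix.toEuclideanLin, Matrix.toLpLin_apply]

theorem inner_real_eq_re_inner (e e' : EuclideanSpace ℂ (Fin N)) :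
    inner ℝ e e' = (inner ℂ e e').re := by
  simp [PiLp.inner_apply, Complex.inner]

theorem inner_matrixRealCLM_left (M : Matrix (Fin N) (Fin N) ℂ)
    (e e' : EuclideanSpace ℂ (Fin N)) :
    inner ℝ (matrixRealCLM M e) e' = inner ℝ e (matrixRealCLM M.conjTranspose e') := by
  rw [inner_real_eq_re_inner, inner_real_eq_re_inner, matrixRealCLM_apply, matrixRealCLM_apply,
    Matrix.toEuclideanLin_conjTranspose_eq_adjoint, LinearMap.adjoint_inner_right]

/-- The Clifford multiplication `x ↦ −i ∑ⱼ xⱼ αʲ`. -/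
def cliffordMul (α : Fin n → Matrix (Fin N) (Fin N) ℂ) :
    EuclideanSpace ℝ (Fin n) →L[ℝ] EuclideanSpace ℂ (Fin N) →L[ℝ] EuclideanSpace ℂ (Fin N) :=
  ∑ j, (EuclideanSpace.proj (𝕜 := ℝ) j).smulRight (matrixRealCLM (-Complex.I • α j))

theorem cliffordMul_apply (α : Fin n → Matrix (Fin N) (Fin N) ℂ) (x : EuclideanSpace ℝ (Fin n))
    (e : EuclideanSpace ℂ (Fin N)) :
    cliffordMul α x e = ∑ j, x j • matrixRealCLM (-Complex.I • α j) e := by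
  simp [cliffordMul, sum_apply]

theorem cliffordMul_single (α : Fin n → Matrix (Fin N) (Fin N) ℂ) (j : Fin n)
    (e : EuclideanSpace ℂ (Fin N)) :
    cliffordMul α (EuclideanSpace.single j 1) e = -Complex.I • Matrix.toEuclideanLin (α j) e := by
  rw [cliffordMul_apply, Finset.sum_eq_single j]
  · simp [matrixRealCLM_apply]
  · intro k _ hk; simp [hk]
  · simp

theorem inner_cliffordMul {α : Fin n → Matrix (Fin N) (Fin N) ℂ} (hα : ∀ j, (α j).IsHermitian)
    (x : EuclideanSpace ℝ (Fin n)) (e e' : EuclideanSpace ℂ (Fin N)) :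
    inner ℝ (cliffordMul α x e) e' = -inner ℝ e (cliffordMul α x e') := by
  simp only [cliffordMul_apply, sum_inner, inner_sum, ← Finset.sum_neg_distrib, inner_smul_left,
    inner_smul_right, inner_matrixRealCLM_left, Matrix.conjTranspose_smul, (hα _).eq, conj_trivial]
  refine Finset.sum_congr rfl fun j _ => ?_
  rw [← mul_neg, ← inner_neg_right]
  simp [matrixRealCLM_apply]

theorem cliffordMul_cliffordMul {α : Fin n → Matrix (Fin N) (Fin N) ℂ}
    (hα2 : ∀ j, α j * α j = 1) (hαα : ∀ j k, j ≠ k → α j * α k + α k * α j = 0)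
    (x : EuclideanSpace ℝ (Fin n)) (e : EuclideanSpace ℂ (Fin N)) :
    cliffordMul α x (cliffordMul α x e) = -(‖x‖ ^ 2) • e := by
  have hS : cliffordMul α x (cliffordMul α x e)
      = ∑ j, ∑ k, (x j * x k) • -matrixRealCLM (α j * α k) e := by
    rw [cliffordMul_apply]
    refine Finset.sum_congr rfl fun j _ => ?_
    rw [cliffordMul_apply, map_sum, Finset.smul_sum]
    refine Finset.sum_congr rfl fun k _ => ?_
    rw [map_smul, smul_smul, matrixRealCLM_matrixRealCLM]
    congr 1
    simp [matrixRealCLM_apply, smul_smul]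
  have h2 : (2 : ℝ) • cliffordMul α x (cliffordMul α x e) = (2 : ℝ) • (-(‖x‖ ^ 2) • e) := by
    calc (2 : ℝ) • cliffordMul α x (cliffordMul α x e)
        = ∑ j, ∑ k, (x j * x k) • -matrixRealCLM (α j * α k + α k * α j) e := by
          rw [two_smul, hS]
          nth_rewrite 2 [Finset.sum_comm]
          rw [← Finset.sum_add_distrib]
          refine Finset.sum_congr rfl fun j _ => ?_
          rw [← Finset.sum_add_distrib]
          refine Finset.sum_congr rfl fun k _ => ?_
          rw [mul_comm (x k), ← smul_add]
          simp [matrixRealCLM_apply]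
          abel
      _ = ∑ j, (x j * x j) • -((2 : ℝ) • e) := by
          refine Finset.sum_congr rfl fun j _ => ?_
          rw [Finset.sum_eq_single j]
          · simp [hα2, matrixRealCLM_apply, two_smul, Matrix.toEuclideanLin]
          · intro k _ hk
            simp [hαα j k hk.symm, matrixRealCLM_apply]
          · simp
      _ = (2 : ℝ) • (-(‖x‖ ^ 2) • e) := by
          rw [← Finset.sum_smul, EuclideanSpace.real_norm_sq_eq]
          simp only [← sq]
          module
  exact smul_right_injective _ (two_ne_zero' ℝ) h2

theorem matrixRealCLM_cliffordMul {α : Fin n → Matrix (Fin N) (Fin N) ℂ}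
    {β : Matrix (Fin N) (Fin N) ℂ} (hαβ : ∀ j, α j * β + β * α j = 0)
    (x : EuclideanSpace ℝ (Fin n)) (e : EuclideanSpace ℂ (Fin N)) :
    matrixRealCLM β (cliffordMul α x e) = -cliffordMul α x (matrixRealCLM β e) := by
  simp only [cliffordMul_apply, map_sum, map_smul, matrixRealCLM_matrixRealCLM,
    ← Finset.sum_neg_distrib]
  refine Finset.sum_congr rfl fun j _ => ?_
  have : β * α j = -(α j * β) := eq_neg_of_add_eq_zero_right (hαβ j)
  simp [matrixRealCLM_apply, this]

end Clifford

/-- Lemma B.3: the Carleman–Berthier–Georgescu inequality in `ℝⁿ`.  For a radial weight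
`φ` with `φ' > 0` satisfying the structural conditions for `r ≥ R`, and any smooth compactly
supported `v` supported in `{|x| > R}`,
`∫ (λ²−m²+φ'²/2) e^{2φ} |v|² ≤ ∫ (n/4 + 2λ²r/φ' + 2rφ') e^{2φ} |(D_m − λ)v|²`. -/
theorem carleman_berthier_georgescu
    (n N : ℕ) (hn : 1 ≤ n) (m : ℝ) (hm : 0 < m)
    (α : Fin n → Matrix (Fin N) (Fin N) ℂ) (β : Matrix (Fin N) (Fin N) ℂ)
    (hαh : ∀ j, (α j).IsHermitian) (hβh : β.IsHermitian)
    (hα2 : ∀ j, α j * α j = 1) (hβ2 : β * β = 1)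
    (hαα : ∀ j k, j ≠ k → α j * α k + α k * α j = 0)
    (hαβ : ∀ j, α j * β + β * α j = 0)
    (lam : ℝ)
    (φ φ' φ'' : ℝ → ℝ)
    (hφ1 : ∀ r ∈ Set.Ioi (0 : ℝ), HasDerivAt φ (φ' r) r)
    (hφ2 : ∀ r ∈ Set.Ioi (0 : ℝ), HasDerivAt φ' (φ'' r) r)
    (hφ''cont : ContinuousOn φ'' (Set.Ioi 0))
    (hφ'pos : ∀ r ∈ Set.Ioi (0 : ℝ), 0 < φ' r)
    (R : ℝ) (hR : 0 < R)
    (hpos : ∀ r : ℝ, R ≤ r → 0 < lam ^ 2 - m ^ 2 + φ' r ^ 2 / 2)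
    (hstruct : ∀ r : ℝ, R ≤ r →
      (n - 1 : ℝ) * φ'' r + (n - 1 : ℝ) ^ 2 * φ' r / r + r * φ'' r ^ 2 / (2 * φ' r)
          + 3 * n / (8 * r) + m / (8 * r * φ' r) + |φ'' r| / (4 * φ' r)
        ≤ (1 / 2) * φ' r ^ 2 + 2 * r * φ' r * φ'' r) :
    ∀ v : EuclideanSpace ℝ (Fin n) → EuclideanSpace ℂ (Fin N),
      ContDiff ℝ (⊤ : ℕ∞) v → HasCompactSupport v → tsupport v ⊆ {x | R < ‖x‖} →
      ∫ x, (lam ^ 2 - m ^ 2 + φ' ‖x‖ ^ 2 / 2) * Real.exp (2 * φ ‖x‖) * ‖v x‖ ^ 2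
        ≤ ∫ x, ((n : ℝ) / 4 + 2 * lam ^ 2 * ‖x‖ / φ' ‖x‖ + 2 * ‖x‖ * φ' ‖x‖)
            * Real.exp (2 * φ ‖x‖) * ‖diracOp m α β v x - (lam : ℂ) • v x‖ ^ 2 := by
  intro v hv hvc hvR
  have hpos : ∀ x ∈ tsupport v, 0 < ‖x‖ := fun x hx => hR.trans (hvR hx)
  have hφ'C : ContDiffOn ℝ 1 φ' (Set.Ioi 0) := by
    have := contDiffOn_succ_of_hasDerivAt (k := 0) isOpen_Ioi hφ2 (by simpa using hφ''cont)
    simpa using this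
  have hφC : ContDiffOn ℝ 2 φ (Set.Ioi 0) := by
    have := contDiffOn_succ_of_hasDerivAt (k := 1) isOpen_Ioi hφ1 (by simpa using hφ'C)
    convert this using 1
    norm_num
  have hv2 : ContDiff ℝ 2 v := contDiff_infty.1 hv 2
  set w : EuclideanSpace ℝ (Fin n) → EuclideanSpace ℂ (Fin N) :=
    fun x => Real.exp (φ ‖x‖) • v x with hw
  have hwv : Function.support w ⊆ Function.support v :=
    Function.support_subset_iff'.2 fun x hx => by simp [hw, Function.notMem_support.1 hx]
  have hw2 : ContDiff ℝ 2 w := by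
    refine contDiff_of_eventuallyEq_zero (w := v) (fun x hx => ?_) (fun x hx => by simp [hw, hx])
    have h1 : ContDiffAt ℝ 2 (fun y => φ ‖y‖) x :=
      (hφC.contDiffAt (Ioi_mem_nhds (hpos x hx))).comp x
        (contDiffAt_norm ℝ (norm_pos_iff.1 (hpos x hx)))
    exact h1.exp.smul hv2.contDiffAt
  have key := integral_conjugated_carleman_le hn (inner_cliffordMul hαh)
    (cliffordMul_cliffordMul hα2 hαα)
    (fun e e' => (inner_matrixRealCLM_left β e e').trans (by rw [hβh.eq]))
    (matrixRealCLM_cliffordMul hαβ)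
    (fun e => by
      rw [matrixRealCLM_matrixRealCLM, hβ2]; simp [matrixRealCLM_apply, Matrix.toEuclideanLin])
    hw2 (hvc.mono hwv) hφ2 hφ''cont hφ'pos hR ((closure_mono hwv).trans hvR) lam m ((n : ℝ) / 4)
    (by positivity) (fun r hr => by
      have h0 := hR.trans_le hr
      have h1 := hφ'pos r h0
      have h2 : 0 ≤ 3 * n / (8 * r) + m / (8 * r * φ' r) + |φ'' r| / (4 * φ' r) := by positivity
      linarith [hstruct r hr])
  have hexp (x : EuclideanSpace ℝ (Fin n)) (e : EuclideanSpace ℂ (Fin N)) :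
      ‖Real.exp (φ ‖x‖) • e‖ ^ 2 = Real.exp (2 * φ ‖x‖) * ‖e‖ ^ 2 := by
    rw [norm_smul, mul_pow, Real.norm_eq_abs, sq_abs, ← Real.exp_nat_mul]
    norm_num
  have hconj (x : EuclideanSpace ℝ (Fin n)) :
      cliffordDirac (cliffordMul α) w x + m • matrixRealCLM β (w x)
        - (lam • w x + (φ' ‖x‖ / ‖x‖) • cliffordMul α x (w x))
      = Real.exp (φ ‖x‖) • (diracOp m α β v x - (lam : ℂ) • v x) := by
    by_cases hx : x ∈ tsupport v
    · have h0 := hpos x hx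
      have hfd : HasFDerivAt w _ x :=
        (((hφ1 _ h0).comp_hasFDerivAt x (hasFDerivAt_norm_inv_smul (norm_pos_iff.1 h0))).exp).smul
          (hv2.differentiable two_ne_zero x).hasFDerivAt
      have hD (j : Fin n) : fderiv ℝ w x (EuclideanSpace.single j 1)
          = Real.exp (φ ‖x‖) • fderiv ℝ v x (EuclideanSpace.single j 1)
            + (φ' ‖x‖ / ‖x‖) • x j • w x := by
        rw [hfd.fderiv]
        simp [hw, smul_smul, EuclideanSpace.inner_single_right]
        congr 1
        ring
      have hA : ∑ j, cliffordMul α (EuclideanSpace.single j 1) (x j • w x)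
          = cliffordMul α x (w x) := by
        have := DFunLike.congr_fun (sum_inner_single_smul (cliffordMul α) x) (w x)
        rw [← this]
        simp
      have hu : cliffordDirac (cliffordMul α) w x
          = Real.exp (φ ‖x‖) • ((-Complex.I) • ∑ j, Matrix.toEuclideanLin (α j)
              (fderiv ℝ v x (EuclideanSpace.single j 1)))
            + (φ' ‖x‖ / ‖x‖) • cliffordMul α x (w x) := by
        simp only [cliffordDirac, hD, map_add, Finset.sum_add_distrib]
        congr 1
        · simp only [map_smul, ← Finset.smul_sum, cliffordMul_single]
        · simp only [map_smul (cliffordMul α _) (φ' ‖x‖ / ‖x‖), ← Finset.smul_sum, hA]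
      have hb : m • matrixRealCLM β (w x)
          = Real.exp (φ ‖x‖) • ((m : ℂ) • Matrix.toEuclideanLin β (v x)) := by
        rw [hw, map_smul, smul_comm, matrixRealCLM_apply, Complex.coe_smul]
      rw [hu, hb, diracOp, Complex.coe_smul lam, smul_sub, smul_add, hw, smul_comm lam]
      abel
    · have hv0 := notMem_tsupport_iff_eventuallyEq.1 hx
      have hw0 := notMem_tsupport_iff_eventuallyEq.1 fun h => hx (closure_mono hwv h)
      simp [cliffordDirac, diracOp, hv0.self_of_nhds, hw0.self_of_nhds, hv0.fderiv_eq,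
        hw0.fderiv_eq]
  simp only [hconj, hexp] at key
  simpa only [hw, hexp, mul_assoc] using key
end
end

section
/- Let n ≥ 1, let g : ℝ → ℝ be smooth with g(0) = 0, and set G(s) = ∫₀^s g(t) dt. Let θ : ℝⁿ → ℝ be a Schwartz function satisfying −Δθ(x) + g(θ(x)) = 0 for all x ∈ ℝⁿ. Then (n−2) · (1/2) ∫_{ℝⁿ} |∇θ(x)|² dx + n ∫_{ℝⁿ} G(θ(x)) dx = 0. -/
open MeasureTheory

open scoped LineDeriv SchwartzMap

section EuclideanSpace

variable {ι : Type*} [Fintype ι]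

theorem SchwartzMap.integrable_mul (f h : 𝓢(EuclideanSpace ℝ ι, ℝ)) :
    Integrable fun x => f x * h x :=
  (SchwartzMap.pairing (ContinuousLinearMap.mul ℝ ℝ) f h).integrable

theorem EuclideanSpace.hasTemperateGrowth_apply (i : ι) :
    (fun x : EuclideanSpace ℝ ι => x i).HasTemperateGrowth :=
  (EuclideanSpace.proj (𝕜 := ℝ) i).hasTemperateGrowth

/-- Multiplication of a Schwartz function by a coordinate. -/
noncomputable def SchwartzMap.coordMul (i : ι) (f : 𝓢(EuclideanSpace ℝ ι, ℝ)) :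
    𝓢(EuclideanSpace ℝ ι, ℝ) :=
  SchwartzMap.smulLeftCLM ℝ (fun x : EuclideanSpace ℝ ι => x i) f

theorem SchwartzMap.coordMul_apply (i : ι) (f : 𝓢(EuclideanSpace ℝ ι, ℝ))
    (x : EuclideanSpace ℝ ι) : SchwartzMap.coordMul i f x = x i * f x :=
  SchwartzMap.smulLeftCLM_apply_apply (EuclideanSpace.hasTemperateGrowth_apply i) f x

theorem SchwartzMap.lineDerivOp_comm (f : 𝓢(EuclideanSpace ℝ ι, ℝ)) (v w x : EuclideanSpace ℝ ι) :
    ∂_{v} (∂_{w} f) x = ∂_{w} (∂_{v} f) x := by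
  have hf : DifferentiableAt ℝ (fderiv ℝ f) x := (fderivCLM ℝ _ ℝ f).differentiableAt
  have h (a b : EuclideanSpace ℝ ι) : ∂_{a} (∂_{b} f) x = fderiv ℝ (fderiv ℝ f) x a b := by
    rw [lineDerivOp_apply_eq_fderiv]
    change fderiv ℝ (fun y => fderiv ℝ f y b) x a = _
    rw [fderiv_clm_apply hf (differentiableAt_const b)]
    simp
  rw [h, h]
  exact ((f.smooth 2).contDiffAt.isSymmSndFDerivAt (by simp)).eq v w

variable [DecidableEq ι]

/-- The partial derivative of a Schwartz function with respect to a coordinate. -/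
noncomputable def SchwartzMap.pderiv (i : ι) (f : 𝓢(EuclideanSpace ℝ ι, ℝ)) :
    𝓢(EuclideanSpace ℝ ι, ℝ) :=
  ∂_{EuclideanSpace.single i (1 : ℝ)} f

theorem SchwartzMap.pderiv_apply (i : ι) (f : 𝓢(EuclideanSpace ℝ ι, ℝ)) (x : EuclideanSpace ℝ ι) :
    pderiv i f x = fderiv ℝ f x (EuclideanSpace.single i 1) :=
  rfl

theorem SchwartzMap.pderiv_comm (i j : ι) (f : 𝓢(EuclideanSpace ℝ ι, ℝ))
    (x : EuclideanSpace ℝ ι) : pderiv i (pderiv j f) x = pderiv j (pderiv i f) x :=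
  f.lineDerivOp_comm _ _ x

theorem SchwartzMap.integral_mul_pderiv (i : ι) (f h : 𝓢(EuclideanSpace ℝ ι, ℝ)) :
    ∫ x, f x * pderiv i h x = -∫ x, pderiv i f x * h x :=
  integral_mul_lineDerivOp_right_eq_neg_left f h _

theorem EuclideanSpace.fderiv_apply_single (i j : ι) (x : EuclideanSpace ℝ ι) :
    fderiv ℝ (fun y : EuclideanSpace ℝ ι => y i) x (EuclideanSpace.single j 1) =
      if i = j then 1 else 0 := by
  have h : HasFDerivAt (fun y : EuclideanSpace ℝ ι => y i) (EuclideanSpace.proj (𝕜 := ℝ) i) x :=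
    (EuclideanSpace.proj (𝕜 := ℝ) i).hasFDerivAt
  rw [h.fderiv]
  simp

theorem integral_coord_mul_fderiv {h : EuclideanSpace ℝ ι → ℝ} (i : ι) (hd : Differentiable ℝ h)
    (hh : Integrable h) (hxh : Integrable fun x => x i * h x)
    (hxh' : Integrable fun x => x i * fderiv ℝ h x (EuclideanSpace.single i 1)) :
    ∫ x, x i * fderiv ℝ h x (EuclideanSpace.single i 1) = -∫ x, h x := by
  have hc : Differentiable ℝ fun x : EuclideanSpace ℝ ι => x i :=
    (EuclideanSpace.proj (𝕜 := ℝ) i).differentiable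
  rw [integral_mul_fderiv_eq_neg_fderiv_mul_of_integrable _ hxh' hxh (fun x _ => hc x)
    (fun x _ => hd x)] <;>
  simp [EuclideanSpace.fderiv_apply_single, hh]

namespace SchwartzMap

theorem pderiv_coordMul (i j : ι) (f : 𝓢(EuclideanSpace ℝ ι, ℝ)) (x : EuclideanSpace ℝ ι) :
    pderiv j (coordMul i f) x =
      (if i = j then f x else 0) + x i * pderiv j f x := by
  have hc : Differentiable ℝ fun x : EuclideanSpace ℝ ι => x i :=
    (EuclideanSpace.proj (𝕜 := ℝ) i).differentiable
  have h : ⇑(coordMul i f) = fun x => x i * f x := funext (coordMul_apply i f)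
  rw [pderiv_apply, pderiv_apply, h,
    fderiv_fun_mul (hc x) f.differentiableAt]
  simp only [add_apply, smul_apply, smul_eq_mul,
    EuclideanSpace.fderiv_apply_single]
  split_ifs <;> ring

theorem integral_coord_mul_mul_pderiv (i : ι) (f : 𝓢(EuclideanSpace ℝ ι, ℝ)) :
    ∫ x, x i * (f x * pderiv i f x) = -(1 / 2) * ∫ x, f x ^ 2 := by
  have key := integral_mul_pderiv i (coordMul i f) f
  have hi := ((coordMul i f).integrable_mul (pderiv i f))
  simp only [pderiv_coordMul, coordMul_apply, if_true, add_mul] at key hi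
  have e : (fun x : EuclideanSpace ℝ ι =>
      x i * pderiv i f x * f x) =
      fun x => x i * f x * pderiv i f x := by
    ext x; ring
  rw [integral_add (f.integrable_mul f) (e ▸ hi), e] at key
  simp only [← mul_assoc, pow_two]
  linarith

theorem integral_coord_mul_pderiv_mul_pderiv_pderiv (i j : ι)
    (f : 𝓢(EuclideanSpace ℝ ι, ℝ)) :
    ∫ x, x i * pderiv i f x *
        pderiv j (pderiv j f) x =
      (1 / 2 - if i = j then 1 else 0) *
        ∫ x, pderiv j f x ^ 2 := by
  have key := integral_mul_pderiv j (coordMul i (pderiv i f)) (pderiv j f)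
  have hi := (coordMul i (pderiv j f)).integrable_mul (pderiv i (pderiv j f))
  have e : (fun x : EuclideanSpace ℝ ι => x i * pderiv j (pderiv i f) x * pderiv j f x) =
      fun x => x i * (pderiv j f x * pderiv i (pderiv j f) x) := by
    ext x; rw [pderiv_comm j i]; ring
  simp only [pderiv_coordMul, coordMul_apply, add_mul] at key hi
  simp only [mul_assoc _ (pderiv j f _)] at hi
  rw [key]
  by_cases hij : i = j
  · subst hij
    simp only [if_true]
    rw [integral_add ((pderiv i f).integrable_mul (pderiv i f)) (e ▸ hi), e,
      integral_coord_mul_mul_pderiv]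
    simp only [← pow_two]
    ring
  · simp only [if_neg hij, zero_mul, zero_add, sub_zero]
    rw [e, integral_coord_mul_mul_pderiv]
    ring

/-- The Pohozaev identity `∫ (x · ∇f) Δf = (n / 2 - 1) ∫ |∇f|²` for Schwartz functions. -/
theorem sum_integral_coord_mul_pderiv_mul_laplacian (f : 𝓢(EuclideanSpace ℝ ι, ℝ)) :
    ∑ i, ∫ x, x i * pderiv i f x *
        ∑ j, pderiv j (pderiv j f) x =
      (Fintype.card ι / 2 - 1) *
        ∫ x, ∑ j, pderiv j f x ^ 2 := by
  have hsq (j : ι) : Integrable fun x => pderiv j f x ^ 2 := by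
    simpa only [pow_two] using integrable_mul _ _
  have hi (i j : ι) : Integrable fun x : EuclideanSpace ℝ ι =>
      x i * pderiv i f x *
        pderiv j (pderiv j f) x := by
    simpa only [coordMul_apply] using
      (coordMul i (pderiv i f)).integrable_mul
        (pderiv j (pderiv j f))
  simp only [Finset.mul_sum]
  simp_rw [fun i => integral_finsetSum Finset.univ fun j _ => hi i j,
    integral_coord_mul_pderiv_mul_pderiv_pderiv]
  rw [integral_finsetSum _ fun j _ => hsq j, Finset.sum_comm, Finset.mul_sum]
  refine Finset.sum_congr rfl fun j _ => ?_
  rw [← Finset.sum_mul, Finset.sum_sub_distrib]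
  congr 1
  simp [div_eq_mul_inv]

end SchwartzMap

end EuclideanSpace

theorem hasDerivAt_primitive {g : ℝ → ℝ} (hg : Continuous g) (s : ℝ) :
    HasDerivAt (fun s => ∫ t in (0 : ℝ)..s, g t) (g s) s :=
  intervalIntegral.integral_hasDerivAt_right (hg.intervalIntegrable _ _)
    (hg.stronglyMeasurableAtFilter _ _) hg.continuousAt

namespace SchwartzMap

theorem exists_bound_on_uIcc {E : Type*} [NormedAddCommGroup E] [NormedSpace ℝ E]
    {g : ℝ → ℝ} (hg : Continuous g) (f : 𝓢(E, ℝ)) :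
    ∃ C, ∀ x, ∀ t ∈ Set.uIcc 0 (f x), ‖g t‖ ≤ C := by
  obtain ⟨C, hC⟩ := (isCompact_Icc (a := -‖f.toBoundedContinuousFunction‖)
    (b := ‖f.toBoundedContinuousFunction‖)).exists_bound_of_continuousOn hg.continuousOn
  have h0 := norm_nonneg f.toBoundedContinuousFunction
  exact ⟨C, fun x t ht => hC t <| Set.uIcc_subset_Icc ⟨neg_nonpos.mpr h0, h0⟩
    (abs_le.mp (f.toBoundedContinuousFunction.norm_coe_le_norm x)) ht⟩

variable {ι : Type*} [Fintype ι] [DecidableEq ι]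

theorem integral_coord_mul_pderiv_mul_comp {g : ℝ → ℝ} (hg : Continuous g) (i : ι)
    (f : 𝓢(EuclideanSpace ℝ ι, ℝ)) :
    ∫ x, x i * pderiv i f x * g (f x) =
      -∫ x, ∫ t in (0 : ℝ)..(f x), g t := by
  obtain ⟨C, hgC⟩ := f.exists_bound_on_uIcc hg
  have hC (x : EuclideanSpace ℝ ι) : ‖∫ t in (0 : ℝ)..(f x), g t‖ ≤ C * ‖f x‖ := by
    simpa using intervalIntegral.norm_integral_le_of_norm_le_const (a := 0) (b := f x)
      fun t ht => hgC x t (Set.uIoc_subset_uIcc ht)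
  have hd (x : EuclideanSpace ℝ ι) : HasFDerivAt (fun x => ∫ t in (0 : ℝ)..(f x), g t)
      (g (f x) • fderiv ℝ f x) x :=
    (hasDerivAt_primitive hg (f x)).comp_hasFDerivAt x (f.hasFDerivAt x)
  have hcont : Continuous fun x => ∫ t in (0 : ℝ)..(f x), g t :=
    continuous_iff_continuousAt.mpr fun x => (hd x).continuousAt
  have hcoord : Continuous fun x : EuclideanSpace ℝ ι => x i :=
    (EuclideanSpace.proj (𝕜 := ℝ) i).continuous
  have e (x : EuclideanSpace ℝ ι) : x i * pderiv i f x * g (f x) =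
      x i * fderiv ℝ (fun x => ∫ t in (0 : ℝ)..(f x), g t) x (EuclideanSpace.single i 1) := by
    rw [(hd x).fderiv, pderiv_apply]
    simp only [smul_apply, smul_eq_mul]
    ring
  simp only [e]
  refine integral_coord_mul_fderiv i (fun x => (hd x).differentiableAt) ?_ ?_ ?_
  · exact (f.integrable.norm.const_mul C).mono' hcont.aestronglyMeasurable (.of_forall hC)
  · refine ((coordMul i f).integrable.norm.const_mul C).mono'
      (hcoord.mul hcont).aestronglyMeasurable (.of_forall fun x => ?_)
    rw [coordMul_apply, norm_mul, norm_mul, mul_left_comm]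
    exact mul_le_mul_of_nonneg_left (hC x) (norm_nonneg _)
  · simp only [← e, ← coordMul_apply]
    exact (coordMul i _).integrable.mul_bdd (c := C)
      (hg.comp f.continuous).aestronglyMeasurable
      (.of_forall fun x => hgC x _ Set.right_mem_uIcc)

end SchwartzMap

/-- The Pohozaev/dilation identity underlying Derrick's theorem (Lemma 1.1): a Schwartz
solution `θ` of `−Δθ + g(θ) = 0` satisfies `(n−2) T(θ) + n V(θ) = 0`, where
`T(θ) = ½∫|∇θ|²` and `V(θ) = ∫G(θ)` with `G(s) = ∫₀^s g`. -/
theorem derrick_pohozaev_identity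
    (n : ℕ) (hn : 1 ≤ n)
    (g : ℝ → ℝ) (hg : ContDiff ℝ (⊤ : ℕ∞) g) (hg0 : g 0 = 0)
    (θ : SchwartzMap (EuclideanSpace ℝ (Fin n)) ℝ)
    (hθ : ∀ x, -(∑ j, fderiv ℝ (fun y => fderiv ℝ (⇑θ) y (EuclideanSpace.single j 1)) x
        (EuclideanSpace.single j 1)) + g (θ x) = 0) :
    ((n : ℝ) - 2) * ((1 / 2) * ∫ x, ∑ j, (fderiv ℝ (⇑θ) x (EuclideanSpace.single j 1)) ^ 2)
      + (n : ℝ) * ∫ x, ∫ t in (0 : ℝ)..(θ x), g t = 0 := by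
  have hΔ (x : EuclideanSpace ℝ (Fin n)) :
      ∑ j, SchwartzMap.pderiv j (SchwartzMap.pderiv j θ) x = g (θ x) :=
    neg_add_eq_zero.mp (hθ x)
  have key := θ.sum_integral_coord_mul_pderiv_mul_laplacian
  simp only [hΔ, SchwartzMap.integral_coord_mul_pderiv_mul_comp hg.continuous,
    Finset.sum_const, Finset.card_univ, Fintype.card_fin,
    nsmul_eq_mul] at key
  simp only [SchwartzMap.pderiv_apply] at key
  linarith
end
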